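/- There exists a constant C > 0 such that the following holds. Let u₀, u₁ be compactly supported smooth functions on ℝ², let f : [0,∞) × ℝ² → ℝ be smooth with compact support in the spatial variable for each time, and let u : [0,∞) × ℝ² → ℝ be the smooth solution of □u = f with u(0,·) = u₀ and ∂_t u(0,·) = u₁. Then for all t ≥ 0, ‖u(t,·)‖_{L²(ℝ²)} ≤ ‖u₀‖_{L²(ℝ²)} + C (1+t)^{1/2} ( ‖u₁‖_{L^{4/3}(ℝ²)} + ∫₀ᵗ ‖f(τ,·)‖_{L^{4/3}(ℝ²)} dτ ). -/

import Mathlib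

open MeasureTheory ENNReal

noncomputable section

/-- A point of space-time `ℝ^{1+2}`: `p = (t, x₁, x₂)`. -/
abbrev Pt := ℝ × ℝ × ℝ

/-- The time derivative `∂ₜ`. -/
def vdt (u : Pt → ℝ) : Pt → ℝ := fun p => fderiv ℝ u p ((1:ℝ), (0:ℝ), (0:ℝ))

/-- The spatial derivative `∂₁`. -/
def vd1 (u : Pt → ℝ) : Pt → ℝ := fun p => fderiv ℝ u p ((0:ℝ), (1:ℝ), (0:ℝ))

/-- The spatial derivative `∂₂`. -/
def vd2 (u : Pt → ℝ) : Pt → ℝ := fun p => fderiv ℝ u p ((0:ℝ), (0:ℝ), (1:ℝ))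

/-- The rotation `Ω₁₂ = x₁∂₂ − x₂∂₁`. -/
def vOm (u : Pt → ℝ) : Pt → ℝ := fun p => p.2.1 * vd2 u p - p.2.2 * vd1 u p

/-- The scaling field `L₀ = t∂ₜ + x₁∂₁ + x₂∂₂`. -/
def vL0 (u : Pt → ℝ) : Pt → ℝ := fun p => p.1 * vdt u p + p.2.1 * vd1 u p + p.2.2 * vd2 u p

/-- The Lorentz boost `L₁ = t∂₁ + x₁∂ₜ`. -/
def vL1 (u : Pt → ℝ) : Pt → ℝ := fun p => p.1 * vd1 u p + p.2.1 * vdt u p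

/-- The Lorentz boost `L₂ = t∂₂ + x₂∂ₜ`. -/
def vL2 (u : Pt → ℝ) : Pt → ℝ := fun p => p.1 * vd2 u p + p.2.2 * vdt u p

/-- The wave operator `□ = ∂ₜ² − ∂₁² − ∂₂²`. -/
def box (u : Pt → ℝ) : Pt → ℝ := fun p => vdt (vdt u) p - vd1 (vd1 u) p - vd2 (vd2 u) p


lemma contDiff_param_aux (n : ℕ) : ∀ {F : Type} [NormedAddCommGroup F] [NormedSpace ℝ F]
    [CompleteSpace F] (G : Pt × ℝ → F), ContDiff ℝ n G →
    ContDiff ℝ n (fun p => ∫ s in (0:ℝ)..1, G (p, s)) := by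
  induction n with
  | zero =>
    intro F _ _ _ G hG
    simp only [Nat.cast_zero, contDiff_zero] at hG ⊢
    exact intervalIntegral.continuous_parametric_intervalIntegral_of_continuous' (by simpa [Function.uncurry_def] using hG) 0 1
  | succ n ih =>
    intro F _ _ _ G hG
    have hG1 : ContDiff ℝ 1 G := hG.of_le (by norm_cast; omega)
    let G' : Pt × ℝ → (Pt →L[ℝ] F) := fun q =>
      (fderiv ℝ G q).comp (ContinuousLinearMap.inl ℝ Pt ℝ)
    have hG' : ContDiff ℝ n G' := by
      have h1 : ContDiff ℝ n (fderiv ℝ G) := hG.fderiv_right (by norm_cast)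
      exact h1.clm_comp contDiff_const
    have hder : ∀ p, HasFDerivAt (fun p => ∫ s in (0:ℝ)..1, G (p, s))
        (∫ s in (0:ℝ)..1, G' (p, s)) p := by
      intro p
      have hK : IsCompact ((Metric.closedBall p 1) ×ˢ (Set.Icc (0:ℝ) 1)) :=
        (isCompact_closedBall p 1).prod isCompact_Icc
      obtain ⟨C, hC⟩ := hK.exists_bound_of_continuousOn hG'.continuous.continuousOn
      refine (intervalIntegral.hasFDerivAt_integral_of_dominated_of_fderiv_le
        (F := fun p s => G (p, s)) (F' := fun p s => G' (p, s)) (bound := fun _ => C)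
        (Metric.closedBall_mem_nhds p one_pos) ?_ ?_ ?_ ?_ ?_ ?_)
      · refine Filter.Eventually.of_forall fun x => ?_
        exact (hG.continuous.comp (by fun_prop : Continuous fun s : ℝ => (x, s))).aestronglyMeasurable
      · exact (hG.continuous.comp (by fun_prop : Continuous fun s : ℝ => (p, s))).intervalIntegrable _ _
      · exact (hG'.continuous.comp (by fun_prop : Continuous fun s : ℝ => (p, s))).aestronglyMeasurable
      · refine Filter.Eventually.of_forall fun s hs x hx => hC (x, s) ⟨hx, ?_⟩
        rw [Set.uIoc_of_le zero_le_one] at hs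
        exact ⟨hs.1.le, hs.2⟩
      · exact intervalIntegrable_const
      · refine Filter.Eventually.of_forall fun s hs x hx => ?_
        have h1 : HasFDerivAt G (fderiv ℝ G (x, s)) (x, s) :=
          (hG1.differentiable (by norm_num) _).hasFDerivAt
        exact h1.comp x (hasFDerivAt_prodMk_left x s)
    push_cast
    rw [contDiff_succ_iff_fderiv]
    refine ⟨fun p => (hder p).differentiableAt, by simp, ?_⟩
    rw [show fderiv ℝ (fun p => ∫ s in (0:ℝ)..1, G (p, s)) = fun p => ∫ s in (0:ℝ)..1, G' (p, s)
      from funext fun p => (hder p).fderiv]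
    exact ih G' hG'

lemma slice_deriv {g : Pt → ℝ} {τ : ℝ} {x : ℝ × ℝ} (hg : DifferentiableAt ℝ g (τ, x)) :
    HasDerivAt (fun s => g (s, x)) (vdt g (τ, x)) τ := by
  have h := hg.hasFDerivAt.comp_hasDerivAt τ
    ((hasDerivAt_id τ).prodMk (hasDerivAt_const τ x))
  exact h

lemma exists_antideriv (u : Pt → ℝ) (hu : ContDiff ℝ (⊤ : ℕ∞) u) :
    ∃ U : Pt → ℝ, ContDiff ℝ (⊤ : ℕ∞) U ∧ (∀ x, U (0, x) = 0) ∧ vdt U = u := by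
  have hc : ContDiff ℝ (⊤ : ℕ∞) (fun p : Pt => p.1 * ∫ s in (0:ℝ)..1, u (s * p.1, p.2)) := by
    refine contDiff_infty.2 fun n => ?_
    refine contDiff_fst.mul (contDiff_param_aux n (fun q : Pt × ℝ => u (q.2 * q.1.1, q.1.2)) ?_)
    exact (hu.of_le (by exact_mod_cast le_top)).comp (by fun_prop)
  have heq : ∀ t x, t * (∫ s in (0:ℝ)..1, u (s * t, x)) = ∫ τ in (0:ℝ)..t, u (τ, x) := by
    intro t x
    have := intervalIntegral.smul_integral_comp_mul_right (a := 0) (b := 1) (fun τ => u (τ, x)) t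
    simpa using this
  refine ⟨_, hc, by simp, ?_⟩
  funext ⟨t, x⟩
  have h1 := slice_deriv (τ := t) (x := x) (hc.differentiable (by simp) _)
  simp only [heq] at h1 ⊢
  have hcont : Continuous fun τ => u (τ, x) := hu.continuous.comp (by fun_prop)
  exact h1.unique (intervalIntegral.integral_hasDerivAt_right (hcont.intervalIntegrable _ _)
    (hcont.stronglyMeasurableAtFilter _ _) hcont.continuousAt)

lemma fderiv_comm2 {U : Pt → ℝ} (hU : ContDiff ℝ 2 U) (p v w : Pt) :
    fderiv ℝ (fun q => fderiv ℝ U q v) p w = fderiv ℝ (fun q => fderiv ℝ U q w) p v := by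
  have hd : DifferentiableAt ℝ (fderiv ℝ U) p :=
    (hU.fderiv_right (m := 1) (by norm_num)).differentiable (by norm_num) p
  rw [fderiv_clm_apply hd (by fun_prop), fderiv_clm_apply hd (by fun_prop)]
  simp
  exact hU.contDiffAt.isSymmSndFDerivAt (by simp) w v

lemma cd_dir {U : Pt → ℝ} (hU : ContDiff ℝ (⊤ : ℕ∞) U) (v : Pt) :
    ContDiff ℝ (⊤ : ℕ∞) (fun q => fderiv ℝ U q v) := by
  have : ContDiff ℝ (⊤ : ℕ∞) (fderiv ℝ U) := hU.fderiv_right (by simp)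
  exact this.clm_apply contDiff_const

lemma cd_vdt {U : Pt → ℝ} (hU : ContDiff ℝ (⊤ : ℕ∞) U) : ContDiff ℝ (⊤ : ℕ∞) (vdt U) := cd_dir hU _
lemma cd_vd1 {U : Pt → ℝ} (hU : ContDiff ℝ (⊤ : ℕ∞) U) : ContDiff ℝ (⊤ : ℕ∞) (vd1 U) := cd_dir hU _
lemma cd_vd2 {U : Pt → ℝ} (hU : ContDiff ℝ (⊤ : ℕ∞) U) : ContDiff ℝ (⊤ : ℕ∞) (vd2 U) := cd_dir hU _

lemma cd_box {U : Pt → ℝ} (hU : ContDiff ℝ (⊤ : ℕ∞) U) : ContDiff ℝ (⊤ : ℕ∞) (box U) :=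
  ((cd_vdt (cd_vdt hU)).sub (cd_vd1 (cd_vd1 hU))).sub (cd_vd2 (cd_vd2 hU))

lemma vdt_vd1 {U : Pt → ℝ} (hU : ContDiff ℝ (⊤ : ℕ∞) U) : vdt (vd1 U) = vd1 (vdt U) := by
  funext p; exact fderiv_comm2 (hU.of_le (by norm_cast)) p _ _
lemma vdt_vd2 {U : Pt → ℝ} (hU : ContDiff ℝ (⊤ : ℕ∞) U) : vdt (vd2 U) = vd2 (vdt U) := by
  funext p; exact fderiv_comm2 (hU.of_le (by norm_cast)) p _ _

lemma vdt_box {U : Pt → ℝ} (hU : ContDiff ℝ (⊤ : ℕ∞) U) : vdt (box U) = box (vdt U) := by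
  have e1 := vdt_vd1 (cd_vd1 hU)
  have e2 := vdt_vd2 (cd_vd2 hU)
  rw [vdt_vd1 hU] at e1
  rw [vdt_vd2 hU] at e2
  funext p
  have d0 : DifferentiableAt ℝ (vdt (vdt U)) p := (cd_vdt (cd_vdt hU)).differentiable (by simp) p
  have d1 : DifferentiableAt ℝ (vd1 (vd1 U)) p := (cd_vd1 (cd_vd1 hU)).differentiable (by simp) p
  have d2 : DifferentiableAt ℝ (vd2 (vd2 U)) p := (cd_vd2 (cd_vd2 hU)).differentiable (by simp) p
  have : vdt (box U) p = vdt (vdt (vdt U)) p - vdt (vd1 (vd1 U)) p - vdt (vd2 (vd2 U)) p := by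
    unfold box
    change fderiv ℝ (fun p => vdt (vdt U) p - vd1 (vd1 U) p - vd2 (vd2 U) p) p _ = _
    rw [fderiv_fun_sub (d0.fun_sub d1) d2, fderiv_fun_sub d0 d1]
    rfl
  rw [this, e1, e2]; rfl

lemma slice_fderiv {g : Pt → ℝ} {τ : ℝ} {x : ℝ × ℝ} (hg : DifferentiableAt ℝ g (τ, x)) :
    HasFDerivAt (fun y => g (τ, y))
      ((fderiv ℝ g (τ, x)).comp (ContinuousLinearMap.inr ℝ ℝ (ℝ × ℝ))) x :=
  hg.hasFDerivAt.comp x (hasFDerivAt_prodMk_right τ x)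

lemma vd_zero {g : Pt → ℝ} (hg : Differentiable ℝ g) {τ : ℝ} (h0 : ∀ x, g (τ, x) = 0) (x : ℝ × ℝ) :
    vd1 g (τ, x) = 0 ∧ vd2 g (τ, x) = 0 := by
  have h := slice_fderiv (hg (τ, x))
  simp only [h0] at h
  have h2 := h.unique (hasFDerivAt_const (0:ℝ) x)
  constructor
  · simpa [vd1] using congrArg (fun L => L ((1:ℝ), (0:ℝ))) h2
  · simpa [vd2] using congrArg (fun L => L ((0:ℝ), (1:ℝ))) h2


lemma hcs_pow {v : ℝ × ℝ → ℝ} (hvs : HasCompactSupport v) (n : ℕ) :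
    HasCompactSupport (fun x => v x ^ (n + 1)) := by
  refine hvs.mono' fun x hx => subset_tsupport _ ?_
  rw [Function.mem_support] at hx ⊢
  contrapose! hx
  simp [hx]

lemma int_pow {v : ℝ × ℝ → ℝ} (hv : Continuous v) (hvs : HasCompactSupport v) (n : ℕ) :
    Integrable (fun x => v x ^ (n + 1)) := by
  have hc : Continuous (fun x => v x ^ (n + 1)) := by fun_prop
  exact hc.integrable_of_hasCompactSupport (hcs_pow hvs n)

lemma cs_real {f g : ℝ × ℝ → ℝ} (hf : Continuous f) (hg : Continuous g)
    (hfs : HasCompactSupport f) (hgs : HasCompactSupport g) (hf0 : ∀ x, 0 ≤ f x) (hg0 : ∀ x, 0 ≤ g x) :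
    (∫ x, f x * g x) ^ 2 ≤ (∫ x, f x ^ 2) * ∫ x, g x ^ 2 := by
  have h := integral_mul_le_Lp_mul_Lq_of_nonneg (μ := (volume : Measure (ℝ × ℝ)))
    (p := 2) (q := 2) (Real.holderConjugate_iff.2 ⟨by norm_num, by norm_num⟩)
    (Filter.Eventually.of_forall hf0) (Filter.Eventually.of_forall hg0)
    (hf.memLp_of_hasCompactSupport hfs) (hg.memLp_of_hasCompactSupport hgs)
  have e1 : 0 ≤ ∫ x, f x ^ 2 := integral_nonneg fun x => sq_nonneg _
  have e2 : 0 ≤ ∫ x, g x ^ 2 := integral_nonneg fun x => sq_nonneg _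
  have e3 : 0 ≤ ∫ x, f x * g x := integral_nonneg fun x => mul_nonneg (hf0 x) (hg0 x)
  simp only [Real.rpow_two, ← Real.sqrt_eq_rpow] at h
  calc _ ≤ (√(∫ x, f x ^ 2) * √(∫ x, g x ^ 2)) ^ 2 := by gcongr
    _ = _ := by rw [mul_pow, Real.sq_sqrt e1, Real.sq_sqrt e2]

lemma clm_norm_le (L : ℝ × ℝ →L[ℝ] ℝ) : ‖L‖ ≤ |L (1, 0)| + |L (0, 1)| := by
  refine L.opNorm_le_bound (by positivity) fun x => ?_
  have : L x = x.1 * L (1, 0) + x.2 * L (0, 1) := by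
    have : x = x.1 • ((1:ℝ), (0:ℝ)) + x.2 • ((0:ℝ), (1:ℝ)) := by ext <;> simp
    conv_lhs => rw [this]
    rw [map_add, map_smul, map_smul]; rfl
  rw [this, Real.norm_eq_abs]
  have h1 : |x.1| ≤ ‖x‖ := norm_fst_le x
  have h2 : |x.2| ≤ ‖x‖ := norm_snd_le x
  calc _ ≤ |x.1| * |L (1, 0)| + |x.2| * |L (0, 1)| := by
        refine (abs_add_le _ _).trans ?_
        rw [abs_mul, abs_mul]
    _ ≤ ‖x‖ * |L (1, 0)| + ‖x‖ * |L (0, 1)| := by gcongr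
    _ = _ := by ring

lemma lady : ∃ C > (0:ℝ), ∀ v : ℝ × ℝ → ℝ, ContDiff ℝ 1 v → HasCompactSupport v →
    ∫ x, v x ^ 4 ≤ C * (∫ x, v x ^ 2) *
      ∫ x, ((fderiv ℝ v x (1, 0)) ^ 2 + (fderiv ℝ v x (0, 1)) ^ 2) := by
  set c : NNReal := lintegralPowLePowLIntegralFDerivConst (volume : Measure (ℝ × ℝ)) 2 with hc
  refine ⟨8 * c + 1, by positivity, fun v hv hvs => ?_⟩
  have hfr : Real.HolderConjugate (Module.finrank ℝ (ℝ × ℝ)) 2 := by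
    rw [Real.holderConjugate_iff]; simp; norm_num
  have hw : ContDiff ℝ 1 (fun x => v x ^ 2) := hv.pow 2
  have hws : HasCompactSupport (fun x => v x ^ 2) := hcs_pow hvs 1
  have h := lintegral_pow_le_pow_lintegral_fderiv (volume : Measure (ℝ × ℝ)) hw hws hfr
  rw [← hc] at h
  have hfd : Continuous (fderiv ℝ v) := hv.continuous_fderiv (by norm_num)
  have hfds : HasCompactSupport (fderiv ℝ v) := hvs.fderiv ℝ
  set g : ℝ × ℝ → ℝ := fun x => |fderiv ℝ v x (1, 0)| + |fderiv ℝ v x (0, 1)| with hg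
  have hgc : Continuous g := by fun_prop
  have hgs : HasCompactSupport g :=
    hfds.comp_left (g := fun L : ℝ × ℝ →L[ℝ] ℝ => |L (1, 0)| + |L (0, 1)|) (by simp)
  have hva : HasCompactSupport (fun x => |v x|) := hvs.comp_left (g := fun y : ℝ => |y|) (by simp)
  have hvg : Continuous fun x => |v x| * g x := (hv.continuous.abs).mul hgc
  have hvgs : HasCompactSupport fun x => |v x| * g x := hgs.mul_left
  have hvgi : Integrable (fun x => |v x| * g x) := hvg.integrable_of_hasCompactSupport hvgs
  have hg0 : ∀ x, 0 ≤ g x := fun x => by positivity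
  have b1 : ∫⁻ x, ‖fderiv ℝ (fun x => v x ^ 2) x‖ₑ ≤ ENNReal.ofReal (2 * ∫ x, |v x| * g x) := by
    rw [← integral_const_mul, ofReal_integral_eq_lintegral_ofReal (hvgi.const_mul 2)
      (Filter.Eventually.of_forall fun x => by have := hg0 x; positivity)]
    refine lintegral_mono fun x => ?_
    rw [← ofReal_norm]
    refine ENNReal.ofReal_le_ofReal ?_
    have hvd : DifferentiableAt ℝ v x := hv.differentiable (by norm_num) x
    rw [fderiv_fun_pow 2 hvd, norm_smul]
    have := clm_norm_le (fderiv ℝ v x)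
    calc _ ≤ ‖2 • v x ^ (2 - 1)‖ * g x := by gcongr
      _ = _ := by simp [abs_mul]; ring
  have b2 : ∫⁻ x, ‖v x ^ 2‖ₑ ^ (2:ℝ) = ENNReal.ofReal (∫ x, v x ^ 4) := by
    have hi : Integrable (fun x => v x ^ 4) := int_pow hv.continuous hvs 3
    rw [ofReal_integral_eq_lintegral_ofReal hi (Filter.Eventually.of_forall fun x => by positivity)]
    refine lintegral_congr fun x => ?_
    rw [← ofReal_norm, Real.norm_of_nonneg (by positivity),
      ENNReal.ofReal_rpow_of_nonneg (by positivity) (by norm_num), Real.rpow_two]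
    ring_nf
  have I0 : 0 ≤ ∫ x, |v x| * g x := integral_nonneg fun x => mul_nonneg (abs_nonneg _) (hg0 x)
  have h3 : ENNReal.ofReal (∫ x, v x ^ 4) ≤ ENNReal.ofReal (c * (2 * ∫ x, |v x| * g x) ^ 2) := by
    rw [← b2]
    refine h.trans ?_
    rw [ENNReal.ofReal_mul (by positivity), ENNReal.ofReal_coe_nnreal]
    gcongr
    refine (ENNReal.rpow_le_rpow b1 (by norm_num)).trans ?_
    rw [ENNReal.ofReal_rpow_of_nonneg (by positivity) (by norm_num), Real.rpow_two]
  rw [ENNReal.ofReal_le_ofReal_iff (by positivity)] at h3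
  have h4 := cs_real hv.continuous.abs hgc hva hgs (fun x => abs_nonneg _) hg0
  simp only [sq_abs] at h4
  have h5 : ∫ x, g x ^ 2 ≤ 2 * ∫ x, ((fderiv ℝ v x (1, 0)) ^ 2 + (fderiv ℝ v x (0, 1)) ^ 2) := by
    rw [← integral_const_mul]
    refine integral_mono ?_ ?_ fun x => ?_
    · exact int_pow hgc hgs 1
    · refine Continuous.integrable_of_hasCompactSupport (by fun_prop) ?_
      exact hfds.comp_left (g := fun L : ℝ × ℝ →L[ℝ] ℝ => 2 * ((L (1, 0)) ^ 2 + (L (0, 1)) ^ 2))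
        (by simp)
    · simp only [hg]
      nlinarith [sq_nonneg (|fderiv ℝ v x (1, 0)| - |fderiv ℝ v x (0, 1)|),
        sq_abs (fderiv ℝ v x (1, 0)), sq_abs (fderiv ℝ v x (0, 1))]
  have n1 : 0 ≤ ∫ x, v x ^ 2 := integral_nonneg fun x => sq_nonneg _
  have n2 : 0 ≤ ∫ x, ((fderiv ℝ v x (1, 0)) ^ 2 + (fderiv ℝ v x (0, 1)) ^ 2) :=
    integral_nonneg fun x => by positivity
  have n3 : (0:ℝ) ≤ c := c.2
  set J := ∫ x, ((fderiv ℝ v x (1, 0)) ^ 2 + (fderiv ℝ v x (0, 1)) ^ 2)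
  set P := ∫ x, v x ^ 2
  calc _ ≤ c * (2 * ∫ x, |v x| * g x) ^ 2 := h3
    _ = 4 * c * (∫ x, |v x| * g x) ^ 2 := by ring
    _ ≤ 4 * c * (P * ∫ x, g x ^ 2) := by gcongr
    _ ≤ 4 * c * (P * (2 * J)) := by gcongr
    _ ≤ (8 * c + 1) * P * J := by nlinarith [mul_nonneg n1 n2]

lemma holder43 {f v : ℝ × ℝ → ℝ} (hf : Continuous f) (hv : Continuous v) :
    ∫⁻ x, ‖f x‖ₑ * ‖v x‖ₑ ≤ eLpNorm f (4 / 3) volume * eLpNorm v 4 volume := by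
  have h := ENNReal.lintegral_mul_le_Lp_mul_Lq (volume : Measure (ℝ × ℝ))
    (p := 4 / 3) (q := 4) (Real.holderConjugate_iff.2 ⟨by norm_num, by norm_num⟩)
    (f := fun x => ‖f x‖ₑ) (g := fun x => ‖v x‖ₑ) hf.enorm.measurable.aemeasurable
    hv.enorm.measurable.aemeasurable
  have t1 : ((4:ENNReal) / 3).toReal = 4 / 3 := by simp
  rw [eLpNorm_eq_lintegral_rpow_enorm_toReal (by simp) (by finiteness), eLpNorm_eq_lintegral_rpow_enorm_toReal (by simp) (by simp),
    t1]
  exact h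

lemma eLp4 {v : ℝ × ℝ → ℝ} (hv : Continuous v) (hvs : HasCompactSupport v) {V : ℝ} (hV : 0 ≤ V)
    (h : ∫ x, v x ^ 4 ≤ V ^ 4) : eLpNorm v 4 volume ≤ ENNReal.ofReal V := by
  have hi : Integrable (fun x => v x ^ 4) := int_pow hv hvs 3
  have e : ∫⁻ x, ‖v x‖ₑ ^ (4:ℝ) = ENNReal.ofReal (∫ x, v x ^ 4) := by
    rw [ofReal_integral_eq_lintegral_ofReal hi (Filter.Eventually.of_forall fun x => by positivity)]
    refine lintegral_congr fun x => ?_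
    rw [← ofReal_norm,
      ENNReal.ofReal_rpow_of_nonneg (by positivity) (by norm_num)]
    congr 1
    rw [show (4:ℝ) = ((4:ℕ):ℝ) by norm_num, Real.rpow_natCast, Real.norm_eq_abs]
    exact Even.pow_abs (by decide) _
  rw [eLpNorm_eq_lintegral_rpow_enorm_toReal (by simp) (by simp)]
  simp only [ENNReal.toReal_ofNat]
  rw [e]
  calc _ ≤ ENNReal.ofReal (V ^ 4) ^ (1 / (4:ℝ)) := by gcongr
    _ = _ := by
      rw [ENNReal.ofReal_rpow_of_nonneg (by positivity) (by norm_num), ← Real.rpow_natCast,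
        ← Real.rpow_mul hV]
      norm_num

/-- integral form of FTC in time -/
lemma ftc_int {h : Pt → ℝ} (hh : ContDiff ℝ 1 h) {B : Set (ℝ × ℝ)} (hB : IsCompact B) {s : ℝ} :
    (∫ x in B, h (s, x)) - (∫ x in B, h (0, x)) = ∫ τ in (0:ℝ)..s, ∫ x in B, vdt h (τ, x) := by
  have hc : Continuous (vdt h) := by
    have := hh.continuous_fderiv (by norm_num)
    unfold vdt; fun_prop
  have hi : ∀ τ, IntegrableOn (fun x => h (τ, x)) B := fun τ =>
    ((hh.continuous.comp (by fun_prop : Continuous fun x : ℝ × ℝ => (τ, x))).continuousOn).integrableOn_compact hB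
  rw [intervalIntegral_integral_swap, ← integral_sub (hi s) (hi 0)]
  · refine integral_congr_ae (Filter.Eventually.of_forall fun x => ?_)
    have : Continuous fun τ : ℝ => vdt h (τ, x) := hc.comp (by fun_prop)
    exact (intervalIntegral.integral_eq_sub_of_hasDerivAt
      (fun τ _ => slice_deriv (hh.differentiable (by norm_num) _)) (this.intervalIntegrable _ _)).symm
  · have : IntegrableOn (vdt h) (Set.uIcc 0 s ×ˢ B) :=
      hc.continuousOn.integrableOn_compact (isCompact_uIcc.prod hB)
    have h2 := this.mono_set (Set.prod_mono_left (t := B) Set.uIoc_subset_uIcc)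
    rw [Measure.prod_restrict]
    exact h2

lemma div_int {g : Pt → ℝ} (hg : ContDiff ℝ 1 g) {B : Set (ℝ × ℝ)} (hB : IsCompact B) {τ : ℝ}
    (h0 : ∀ x, x ∉ B → g (τ, x) = 0) :
    ∫ x in B, vd1 g (τ, x) = 0 ∧ ∫ x in B, vd2 g (τ, x) = 0 := by
  set k : ℝ × ℝ → ℝ := fun x => g (τ, x) with hk
  have hkc : ContDiff ℝ 1 k := hg.comp (by fun_prop)
  have hks : HasCompactSupport k := HasCompactSupport.intro hB h0
  have key : ∀ v : ℝ × ℝ, ∫ x in B, fderiv ℝ k x v = 0 := by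
    intro v
    have hcont : Continuous fun x => fderiv ℝ k x v := by
      have := hkc.continuous_fderiv (by norm_num)
      fun_prop
    have hs : HasCompactSupport fun x => fderiv ℝ k x v := hks.fderiv_apply ℝ v
    rw [setIntegral_eq_integral_of_forall_compl_eq_zero]
    · have := integral_mul_fderiv_eq_neg_fderiv_mul_of_integrable (μ := (volume : Measure (ℝ × ℝ)))
        (f := fun _ => (1:ℝ)) (g := k) (v := v) (by simp)
        (by simpa using hcont.integrable_of_hasCompactSupport hs)
        (by simpa using hkc.continuous.integrable_of_hasCompactSupport hks)
        (by simp) (fun x _ => hkc.differentiable (by norm_num) x)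
      simpa using this
    · intro x hx
      have : k =ᶠ[nhds x] fun _ => 0 := by
        filter_upwards [hB.isClosed.isOpen_compl.mem_nhds hx] with y hy using h0 y hy
      rw [this.fderiv_eq]; simp
  have e : ∀ x v, fderiv ℝ k x v = fderiv ℝ g (τ, x) (0, v) := by
    intro x v
    rw [(slice_fderiv (hg.differentiable (by norm_num) _)).fderiv]; simp
  constructor
  · have := key (1, 0)
    simp only [e] at this
    exact this
  · have := key (0, 1)
    simp only [e] at this
    exact this


lemma hasDerivAt_maxpow (k : ℕ) (y : ℝ) :
    HasDerivAt (fun y : ℝ => (max y 0) ^ (k + 2)) ((k + 2) * (max y 0) ^ (k + 1)) y := by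
  rcases lt_trichotomy y 0 with h | h | h
  · have e : (fun y : ℝ => (max y 0) ^ (k + 2)) =ᶠ[nhds y] fun _ => 0 := by
      filter_upwards [gt_mem_nhds h] with z hz
      rw [max_eq_right hz.le]; simp
    rw [max_eq_right h.le]
    simpa using (hasDerivAt_const y (0:ℝ)).congr_of_eventuallyEq e
  · subst h
    have : (fun h : ℝ => (max h 0) ^ (k + 2)) =o[nhds 0] fun h => h := by
      have h1 : (fun h : ℝ => (max h 0) ^ (k + 2)) =O[nhds 0] fun h => h ^ (k + 2) := by
        refine Asymptotics.isBigO_of_le _ fun h => ?_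
        rw [norm_pow, norm_pow]
        gcongr
        simp only [Real.norm_eq_abs]
        rcases le_total h 0 with h' | h' <;> simp [h']
      have h2 : (fun h : ℝ => h ^ (k + 2)) =o[nhds 0] fun h : ℝ => h := by
        simpa using Asymptotics.isLittleO_pow_pow (𝕜 := ℝ) (m := 1) (n := k + 2) (by omega)
      exact h1.trans_isLittleO h2
    rw [hasDerivAt_iff_isLittleO_nhds_zero]
    simpa using this
  · have e : (fun y : ℝ => (max y 0) ^ (k + 2)) =ᶠ[nhds y] fun y => y ^ (k + 2) := by
      filter_upwards [lt_mem_nhds h] with z hz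
      rw [max_eq_left (le_of_lt hz)]
    rw [max_eq_left h.le]
    simpa using (hasDerivAt_pow (k + 2) y).congr_of_eventuallyEq e

lemma contDiff_maxpow (k : ℕ) : ContDiff ℝ 1 (fun y : ℝ => (max y 0) ^ (k + 2)) := by
  rw [contDiff_one_iff_deriv]
  refine ⟨fun y => (hasDerivAt_maxpow k y).differentiableAt, ?_⟩
  rw [show deriv (fun y : ℝ => (max y 0) ^ (k + 2)) = fun y : ℝ => ((k:ℝ) + 2) * (max y 0) ^ (k + 1) from
    funext fun y => (hasDerivAt_maxpow k y).deriv]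
  fun_prop

/-- `⟨x⟩ = (1+|x|²)^{1/2}` -/
def jb (x : ℝ × ℝ) : ℝ := √(1 + x.1 ^ 2 + x.2 ^ 2)

lemma jb_pos (x : ℝ × ℝ) : 0 < jb x := Real.sqrt_pos.2 (by positivity)
lemma jb_sq (x : ℝ × ℝ) : jb x ^ 2 = 1 + x.1 ^ 2 + x.2 ^ 2 := Real.sq_sqrt (by positivity)

lemma jb_contDiff : ContDiff ℝ 1 jb := by
  unfold jb
  refine ContDiff.sqrt (by fun_prop) fun x => ?_
  positivity

def arg (R : ℝ) (p : Pt) : ℝ := 1 - (p.1 + jb p.2) / R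

lemma arg_contDiff (R : ℝ) : ContDiff ℝ 1 (arg R) := by
  have := jb_contDiff
  unfold arg
  fun_prop

def wt (R : ℝ) (k : ℕ) (p : Pt) : ℝ := (max (arg R p) 0) ^ k

lemma wt_contDiff (R : ℝ) (k : ℕ) : ContDiff ℝ 1 (wt R (k + 2)) :=
  (contDiff_maxpow k).comp (arg_contDiff R)

lemma wt_cont (R : ℝ) (k : ℕ) : Continuous (wt R k) := by
  have := (arg_contDiff R).continuous
  unfold wt; fun_prop

lemma wt_nonneg (R : ℝ) (k : ℕ) (p : Pt) : 0 ≤ wt R k p := by unfold wt; positivity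

lemma wt_mul (R : ℝ) (k l : ℕ) (p : Pt) : wt R k p * wt R l p = wt R (k + l) p := by
  unfold wt; rw [pow_add]

lemma arg_le {R : ℝ} (hR : 0 < R) {p : Pt} (hp : 0 ≤ p.1) : arg R p ≤ 1 := by
  have := jb_pos p.2
  unfold arg
  have : 0 ≤ (p.1 + jb p.2) / R := by positivity
  linarith

lemma wt_le_one {R : ℝ} (hR : 0 < R) (k : ℕ) {p : Pt} (hp : 0 ≤ p.1) : wt R k p ≤ 1 :=
  pow_le_one₀ (by positivity) (max_le (arg_le hR hp) zero_le_one)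

lemma wt_anti {R : ℝ} (hR : 0 < R) {k l : ℕ} (h : k ≤ l) {p : Pt} (hp : 0 ≤ p.1) :
    wt R l p ≤ wt R k p :=
  pow_le_pow_of_le_one (by positivity) (max_le (arg_le hR hp) zero_le_one) h

lemma wt_zero {R : ℝ} (hR : 0 < R) {k : ℕ} (hk : k ≠ 0) {τ : ℝ} (hp : 0 ≤ τ) {x : ℝ × ℝ}
    (hx : x ∉ Metric.closedBall (0 : ℝ × ℝ) R) : wt R k (τ, x) = 0 := by
  have hj : R ≤ jb x := by
    simp only [Metric.mem_closedBall, dist_zero_right, not_le] at hx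
    have : ‖x‖ ≤ jb x := by
      rw [Prod.norm_def]
      refine max_le ?_ ?_ <;> refine Real.le_sqrt_of_sq_le ?_ <;>
        simp only [Real.norm_eq_abs, sq_abs] <;> nlinarith [sq_nonneg x.1, sq_nonneg x.2]
    linarith
  have : arg R (τ, x) ≤ 0 := by
    unfold arg
    have : 1 ≤ (τ + jb x) / R := by rw [le_div_iff₀ hR]; linarith
    simpa using this
  unfold wt
  rw [max_eq_right this]
  exact zero_pow hk

lemma wt_fderiv (R : ℝ) (k : ℕ) (p v : Pt) :
    fderiv ℝ (wt R (k + 2)) p v =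
      - ((k + 2) / R) * wt R (k + 1) p * (v.1 + (p.2.1 * v.2.1 + p.2.2 * v.2.2) / jb p.2) := by
  have hne : 1 + p.2.1 ^ 2 + p.2.2 ^ 2 ≠ 0 := by positivity
  -- derivative along the line
  have hline : HasDerivAt (fun s : ℝ => arg R (p + s • v))
      (-(v.1 + (p.2.1 * v.2.1 + p.2.2 * v.2.2) / jb p.2) / R) 0 := by
    have h1 : HasDerivAt (fun s : ℝ => 1 + (p.2.1 + s * v.2.1) ^ 2 + (p.2.2 + s * v.2.2) ^ 2)
        (2 * p.2.1 * v.2.1 + 2 * p.2.2 * v.2.2) 0 := by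
      have a1 : HasDerivAt (fun s : ℝ => p.2.1 + s * v.2.1) v.2.1 0 := by
        simpa using ((hasDerivAt_id (0:ℝ)).mul_const v.2.1).const_add p.2.1
      have a2 : HasDerivAt (fun s : ℝ => p.2.2 + s * v.2.2) v.2.2 0 := by
        simpa using ((hasDerivAt_id (0:ℝ)).mul_const v.2.2).const_add p.2.2
      have := ((a1.fun_pow 2).const_add 1).fun_add (a2.fun_pow 2)
      simpa using this
    have h2 := h1.sqrt (by simpa using hne)
    have a0 : HasDerivAt (fun s : ℝ => p.1 + s * v.1) v.1 0 := by
      simpa using ((hasDerivAt_id (0:ℝ)).mul_const v.1).const_add p.1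
    have h3 := ((a0.fun_add h2).div_const R).const_sub 1
    refine (h3.congr_deriv ?_).congr_of_eventuallyEq
      (Filter.Eventually.of_forall fun s => by simp [arg, jb])
    simp only [jb, zero_mul, add_zero]
    have : 0 < √(1 + p.2.1 ^ 2 + p.2.2 ^ 2) := Real.sqrt_pos.2 (by positivity)
    field_simp
  have hm := (hasDerivAt_maxpow k (arg R p))
  have hm' : HasDerivAt (fun y : ℝ => (max y 0) ^ (k + 2)) ((k + 2) * (max (arg R p) 0) ^ (k + 1))
      (arg R (p + (0:ℝ) • v)) := by simpa using hm
  have hcomp := hm'.comp (0:ℝ) hline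
  have hd : HasFDerivAt (wt R (k + 2)) (fderiv ℝ (wt R (k + 2)) p) p :=
    ((wt_contDiff R k).differentiable (by norm_num) p).hasFDerivAt
  have hl : HasDerivAt (fun s : ℝ => wt R (k + 2) (p + s • v)) (fderiv ℝ (wt R (k + 2)) p v) 0 :=
    hd.hasLineDerivAt v
  rw [hl.unique hcomp]
  unfold wt
  ring

lemma wt_dt (R : ℝ) (k : ℕ) (p : Pt) :
    vdt (wt R (k + 2)) p = - ((k + 2) / R) * wt R (k + 1) p := by
  rw [vdt, wt_fderiv]; simp
lemma wt_d1 (R : ℝ) (k : ℕ) (p : Pt) :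
    vd1 (wt R (k + 2)) p = - ((k + 2) / R) * wt R (k + 1) p * (p.2.1 / jb p.2) := by
  rw [vd1, wt_fderiv]; simp
lemma wt_d2 (R : ℝ) (k : ℕ) (p : Pt) :
    vd2 (wt R (k + 2)) p = - ((k + 2) / R) * wt R (k + 1) p * (p.2.2 / jb p.2) := by
  rw [vd2, wt_fderiv]; simp

lemma jb_xi (x : ℝ × ℝ) : (x.1 / jb x) ^ 2 + (x.2 / jb x) ^ 2 ≤ 1 := by
  have := jb_pos x
  rw [div_pow, div_pow, ← add_div, div_le_one (by positivity), jb_sq]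
  linarith


/-- localized energy density (twice) -/
def edens (U : Pt → ℝ) (p : Pt) : ℝ := vdt U p ^ 2 + vd1 U p ^ 2 + vd2 U p ^ 2

def Qen (U : Pt → ℝ) (R s : ℝ) : ℝ :=
  ∫ x in Metric.closedBall (0 : ℝ × ℝ) R, wt R 4 (s, x) * edens U (s, x)

def Pen (U : Pt → ℝ) (R s : ℝ) : ℝ :=
  ∫ x in Metric.closedBall (0 : ℝ × ℝ) R, wt R 4 (s, x) * U (s, x) ^ 2

lemma cont_ball {g : Pt → ℝ} (hg : Continuous g) (R : ℝ) :
    Continuous fun s => ∫ x in Metric.closedBall (0 : ℝ × ℝ) R, g (s, x) :=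
  continuous_parametric_integral_of_continuous (f := fun s x => g (s, x))
    (by simpa [Function.uncurry_def] using hg) (isCompact_closedBall _ _)

lemma int_ball {g : Pt → ℝ} (hg : Continuous g) (R s : ℝ) :
    IntegrableOn (fun x => g (s, x)) (Metric.closedBall (0 : ℝ × ℝ) R) :=
  (hg.comp (by fun_prop : Continuous fun x : ℝ × ℝ => (s, x))).continuousOn.integrableOn_compact
    (isCompact_closedBall _ _)

lemma edens_cd {U : Pt → ℝ} (hU : ContDiff ℝ (⊤ : ℕ∞) U) : ContDiff ℝ (⊤ : ℕ∞) (edens U) :=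
  (((cd_vdt hU).pow 2).add ((cd_vd1 hU).pow 2)).add ((cd_vd2 hU).pow 2)

lemma Qen_cont {U : Pt → ℝ} (hU : ContDiff ℝ (⊤ : ℕ∞) U) (R : ℝ) : Continuous (Qen U R) :=
  cont_ball ((wt_cont R 4).mul (edens_cd hU).continuous) R

lemma Pen_cont {U : Pt → ℝ} (hU : ContDiff ℝ (⊤ : ℕ∞) U) (R : ℝ) : Continuous (Pen U R) :=
  cont_ball ((wt_cont R 4).mul (hU.continuous.pow 2)) R

lemma Pen_bound {U : Pt → ℝ} (hU : ContDiff ℝ (⊤ : ℕ∞) U) (hU0 : ∀ x, U (0, x) = 0)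
    {R T t M2 : ℝ} (hR : 0 < R) (hT : 0 < T) (ht : 0 ≤ t) (htT : t ≤ T)
    (hQ : ∀ s ∈ Set.Icc 0 t, Qen U R s ≤ M2) : ∀ s ∈ Set.Icc 0 t, Pen U R s ≤ 4 * T ^ 2 * M2 := by
  obtain ⟨s₀, hs₀, hmax⟩ := isCompact_Icc.exists_isMaxOn (Set.nonempty_Icc.2 ht)
    (Pen_cont hU R).continuousOn
  have hcu : Continuous (vdt U) := (cd_vdt hU).continuous
  have hcQ := (edens_cd hU).continuous
  have hcw := wt_cont R 4
  have hcU := hU.continuous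
  have hM2 : 0 ≤ M2 := by
    refine le_trans ?_ (hQ 0 ⟨le_rfl, ht⟩)
    exact integral_nonneg fun x => mul_nonneg (wt_nonneg _ _ _) (by unfold edens; positivity)
  set m := Pen U R s₀ with hm
  have hm0 : 0 ≤ m := integral_nonneg fun x => mul_nonneg (wt_nonneg _ _ _) (by positivity)
  have hcd : ContDiff ℝ 1 (fun p => wt R 4 p * U p ^ 2) :=
    (wt_contDiff R 2).mul ((hU.of_le (by norm_cast)).pow 2)
  have hftc := ftc_int hcd (isCompact_closedBall (0 : ℝ × ℝ) R) (s := s₀)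
  have hz : ∫ x in Metric.closedBall (0 : ℝ × ℝ) R, wt R 4 (0, x) * U (0, x) ^ 2 = 0 := by
    simp [hU0]
  have hcv : Continuous (vdt (fun p => wt R 4 p * U p ^ 2)) := by
    have := hcd.continuous_fderiv (by norm_num)
    unfold vdt; fun_prop
  have hpt : ∀ p : Pt, vdt (fun p => wt R 4 p * U p ^ 2) p ≤
      2 * T * (wt R 4 p * edens U p) + (1 / (2 * T)) * (wt R 4 p * U p ^ 2) := by
    intro p
    have dw : DifferentiableAt ℝ (wt R 4) p := (wt_contDiff R 2).differentiable (by norm_num) p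
    have dU : DifferentiableAt ℝ U p := hU.differentiable (by simp) p
    have e : vdt (fun p => wt R 4 p * U p ^ 2) p
        = wt R 4 p * (2 * U p * vdt U p) + U p ^ 2 * vdt (wt R 4) p := by
      simp only [vdt]
      rw [fderiv_fun_mul dw (dU.fun_pow 2), fderiv_fun_pow 2 dU]
      simp
    rw [e, show (4:ℕ) = 2 + 2 from rfl, wt_dt]
    have w3 := wt_nonneg R (2 + 1) p
    have w4 := wt_nonneg R (2 + 2) p
    have h1 : U p ^ 2 * (-(((2:ℕ):ℝ) + 2) / R * wt R (2 + 1) p) ≤ 0 := by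
      have : 0 ≤ U p ^ 2 * ((((2:ℕ):ℝ) + 2) / R * wt R (2 + 1) p) := by positivity
      linarith [show U p ^ 2 * (-(((2:ℕ):ℝ) + 2) / R * wt R (2 + 1) p) =
        -(U p ^ 2 * ((((2:ℕ):ℝ) + 2) / R * wt R (2 + 1) p)) by ring]
    have h2 : 2 * U p * vdt U p ≤ 2 * T * edens U p + (1 / (2 * T)) * U p ^ 2 := by
      have : 2 * T * vdt U p ^ 2 + (1 / (2 * T)) * U p ^ 2 - 2 * U p * vdt U p
        = (1 / (2 * T)) * (2 * T * vdt U p - U p) ^ 2 := by field_simp; ring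
      have h3 : 0 ≤ (1 / (2 * T)) * (2 * T * vdt U p - U p) ^ 2 := by positivity
      have h4 : 2 * T * vdt U p ^ 2 ≤ 2 * T * edens U p := by
        gcongr; unfold edens; nlinarith [sq_nonneg (vd1 U p), sq_nonneg (vd2 U p)]
      linarith
    have h5 := mul_le_mul_of_nonneg_left h2 w4
    rw [← neg_div]
    linarith
  have hint : ∫ τ in (0:ℝ)..s₀, ∫ x in Metric.closedBall (0 : ℝ × ℝ) R,
      vdt (fun p => wt R 4 p * U p ^ 2) (τ, x) ≤
      ∫ τ in (0:ℝ)..s₀, (2 * T * M2 + (1 / (2 * T)) * m) := by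
    refine intervalIntegral.integral_mono_on hs₀.1 ((cont_ball hcv R).intervalIntegrable _ _)
      (by simp) fun τ hτ => ?_
    have hτ' : τ ∈ Set.Icc 0 t := ⟨hτ.1, hτ.2.trans hs₀.2⟩
    have i1 := int_ball (hcw.fun_mul hcQ) R τ
    have i2 := int_ball (hcw.fun_mul (hcU.fun_pow 2)) R τ
    calc _ ≤ ∫ x in Metric.closedBall (0 : ℝ × ℝ) R, (2 * T * (wt R 4 (τ, x) * edens U (τ, x)) +
          (1 / (2 * T)) * (wt R 4 (τ, x) * U (τ, x) ^ 2)) :=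
          integral_mono (int_ball hcv R τ) ((i1.const_mul _).add (i2.const_mul _)) fun x => hpt _
      _ = 2 * T * Qen U R τ + (1 / (2 * T)) * Pen U R τ := by
          rw [integral_add (i1.const_mul _) (i2.const_mul _), integral_const_mul,
            integral_const_mul]; rfl
      _ ≤ _ := by
          have a1 := hQ τ hτ'
          have a2 : Pen U R τ ≤ m := hmax hτ'
          gcongr
  rw [← hftc, hz, sub_zero, intervalIntegral.integral_const] at hint
  change m ≤ _ at hint
  simp only [sub_zero, smul_eq_mul] at hint
  have hsT : s₀ ≤ T := hs₀.2.trans htT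
  have : m ≤ T * (2 * T * M2 + (1 / (2 * T)) * m) := hint.trans (by gcongr)
  have e : T * (2 * T * M2 + (1 / (2 * T)) * m) = 2 * T ^ 2 * M2 + m / 2 := by field_simp
  intro s hs
  have : Pen U R s ≤ m := hmax hs
  linarith

lemma energy_ineq {U : Pt → ℝ} (hU : ContDiff ℝ (⊤ : ℕ∞) U) (hU0 : ∀ x, U (0, x) = 0)
    {R s : ℝ} (hR : 0 < R) (hs : 0 ≤ s) :
    1 / 2 * Qen U R s ≤ 1 / 2 * Qen U R 0 +
      (∫ x in Metric.closedBall (0 : ℝ × ℝ) R, wt R 4 (s, x) * box U (s, x) * U (s, x)) +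
      ∫ τ in (0:ℝ)..s, ∫ x in Metric.closedBall (0 : ℝ × ℝ) R,
        (4 / R * (wt R 3 (τ, x) * box U (τ, x) * U (τ, x)) -
          wt R 4 (τ, x) * vdt (box U) (τ, x) * U (τ, x)) := by
  have cu := cd_vdt hU
  have c1 := cd_vd1 hU
  have c2 := cd_vd2 hU
  have cF := cd_box hU
  have cf := cd_vdt cF
  have cQ := edens_cd hU
  have cw : ContDiff ℝ 1 (wt R 4) := wt_contDiff R 2
  have cw3 := wt_cont R 3
  have l1 : ((1:ℕ∞) : WithTop ℕ∞) ≤ ((⊤ : ℕ∞) : WithTop ℕ∞) := by norm_cast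
  have u1 : ContDiff ℝ 1 (vdt U) := cu.of_le l1
  have a1 : ContDiff ℝ 1 (vd1 U) := c1.of_le l1
  have a2 : ContDiff ℝ 1 (vd2 U) := c2.of_le l1
  have F1 : ContDiff ℝ 1 (box U) := cF.of_le l1
  have U1 : ContDiff ℝ 1 U := hU.of_le l1
  have Q1 : ContDiff ℝ 1 (edens U) := cQ.of_le l1
  have hh : ContDiff ℝ 1 (fun p => 1 / 2 * (wt R 4 p * edens U p) - wt R 4 p * box U p * U p) := by
    fun_prop
  have g1 : ContDiff ℝ 1 (fun p => wt R 4 p * (vdt U p * vd1 U p)) := by fun_prop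
  have g2 : ContDiff ℝ 1 (fun p => wt R 4 p * (vdt U p * vd2 U p)) := by fun_prop
  have hB := isCompact_closedBall (0 : ℝ × ℝ) R
  have hftc := ftc_int hh hB (s := s)
  have hpt : ∀ p : Pt, vdt (fun p => 1 / 2 * (wt R 4 p * edens U p) - wt R 4 p * box U p * U p) p ≤
      vd1 (fun p => wt R 4 p * (vdt U p * vd1 U p)) p
      + vd2 (fun p => wt R 4 p * (vdt U p * vd2 U p)) p
      + (4 / R * (wt R 3 p * box U p * U p) - wt R 4 p * vdt (box U) p * U p) := by
    intro p
    have dw : DifferentiableAt ℝ (wt R 4) p := cw.differentiable (by norm_num) p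
    have du : DifferentiableAt ℝ (vdt U) p := u1.differentiable (by norm_num) p
    have d1 : DifferentiableAt ℝ (vd1 U) p := a1.differentiable (by norm_num) p
    have d2 : DifferentiableAt ℝ (vd2 U) p := a2.differentiable (by norm_num) p
    have dF : DifferentiableAt ℝ (box U) p := F1.differentiable (by norm_num) p
    have dU : DifferentiableAt ℝ U p := U1.differentiable (by norm_num) p
    have dQ : DifferentiableAt ℝ (edens U) p := Q1.differentiable (by norm_num) p
    have eQ : vdt (edens U) p = 2 * vdt U p * vdt (vdt U) p + 2 * vd1 U p * vd1 (vdt U) p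
        + 2 * vd2 U p * vd2 (vdt U) p := by
      rw [← vdt_vd1 hU, ← vdt_vd2 hU]
      change fderiv ℝ (fun p => vdt U p ^ 2 + vd1 U p ^ 2 + vd2 U p ^ 2) p _ = _
      rw [fderiv_fun_add ((du.fun_pow 2).fun_add (d1.fun_pow 2)) (d2.fun_pow 2),
        fderiv_fun_add (du.fun_pow 2) (d1.fun_pow 2), fderiv_fun_pow 2 du, fderiv_fun_pow 2 d1,
        fderiv_fun_pow 2 d2]
      simp [vdt]
    have eh : vdt (fun p => 1 / 2 * (wt R 4 p * edens U p) - wt R 4 p * box U p * U p) p =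
        1 / 2 * (wt R 4 p * vdt (edens U) p + edens U p * vdt (wt R 4) p)
        - (wt R 4 p * box U p * vdt U p + U p * (wt R 4 p * vdt (box U) p
          + box U p * vdt (wt R 4) p)) := by
      change fderiv ℝ (fun p => 1 / 2 * (wt R 4 p * edens U p) - wt R 4 p * box U p * U p) p _ = _
      rw [fderiv_fun_sub ((dw.fun_mul dQ).const_mul _) ((dw.fun_mul dF).fun_mul dU),
        fderiv_const_mul (dw.fun_mul dQ), fderiv_fun_mul dw dQ,
        fderiv_fun_mul (dw.fun_mul dF) dU, fderiv_fun_mul dw dF]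
      simp [vdt]
      ring
    have e1 : vd1 (fun p => wt R 4 p * (vdt U p * vd1 U p)) p =
        wt R 4 p * (vdt U p * vd1 (vd1 U) p + vd1 U p * vd1 (vdt U) p)
          + vdt U p * vd1 U p * vd1 (wt R 4) p := by
      change fderiv ℝ (fun p => wt R 4 p * (vdt U p * vd1 U p)) p _ = _
      rw [fderiv_fun_mul dw (du.fun_mul d1), fderiv_fun_mul du d1]
      simp [vd1]
      ring
    have e2 : vd2 (fun p => wt R 4 p * (vdt U p * vd2 U p)) p =
        wt R 4 p * (vdt U p * vd2 (vd2 U) p + vd2 U p * vd2 (vdt U) p)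
          + vdt U p * vd2 U p * vd2 (wt R 4) p := by
      change fderiv ℝ (fun p => wt R 4 p * (vdt U p * vd2 U p)) p _ = _
      rw [fderiv_fun_mul dw (du.fun_mul d2), fderiv_fun_mul du d2]
      simp [vd2]
      ring
    have ebox : vdt (vdt U) p = box U p + vd1 (vd1 U) p + vd2 (vd2 U) p := by
      unfold box; ring
    have wt' := wt_dt R 2 p
    have w1' := wt_d1 R 2 p
    have w2' := wt_d2 R 2 p
    norm_num at wt' w1' w2'
    rw [eh, e1, e2, eQ, ebox, wt', w1', w2']
    set ξ := p.2.1 / jb p.2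
    set η := p.2.2 / jb p.2
    have hxi : ξ ^ 2 + η ^ 2 ≤ 1 := jb_xi p.2
    have w3 := wt_nonneg R 3 p
    have hc : 0 ≤ 4 / R * wt R 3 p := by positivity
    have key : 0 ≤ 1 / 2 * edens U p - vdt U p * (ξ * vd1 U p + η * vd2 U p) := by
      unfold edens
      nlinarith [sq_nonneg (vd1 U p - ξ * vdt U p), sq_nonneg (vd2 U p - η * vdt U p),
        mul_nonneg (sq_nonneg (vdt U p)) (sub_nonneg.2 hxi)]
    have := mul_nonneg hc key
    linarith
  have hcd : ∀ {g : Pt → ℝ}, ContDiff ℝ 1 g → ∀ v : Pt, Continuous fun p => fderiv ℝ g p v := by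
    intro g hg v
    have := hg.continuous_fderiv (by norm_num)
    fun_prop
  have k0 : Continuous (vdt (fun p => 1 / 2 * (wt R 4 p * edens U p) - wt R 4 p * box U p * U p)) :=
    hcd hh _
  have k1 : Continuous (vd1 (fun p => wt R 4 p * (vdt U p * vd1 U p))) := hcd g1 _
  have k2 : Continuous (vd2 (fun p => wt R 4 p * (vdt U p * vd2 U p))) := hcd g2 _
  have k3 : Continuous (fun p => 4 / R * (wt R 3 p * box U p * U p)
      - wt R 4 p * vdt (box U) p * U p) := by
    have z1 := cw.continuous
    have z2 := cF.continuous
    have z3 := cf.continuous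
    have z4 := hU.continuous
    fun_prop
  have hint : ∫ τ in (0:ℝ)..s, ∫ x in Metric.closedBall (0 : ℝ × ℝ) R,
      vdt (fun p => 1 / 2 * (wt R 4 p * edens U p) - wt R 4 p * box U p * U p) (τ, x) ≤
      ∫ τ in (0:ℝ)..s, ∫ x in Metric.closedBall (0 : ℝ × ℝ) R,
        (4 / R * (wt R 3 (τ, x) * box U (τ, x) * U (τ, x)) -
          wt R 4 (τ, x) * vdt (box U) (τ, x) * U (τ, x)) := by
    refine intervalIntegral.integral_mono_on hs ((cont_ball k0 R).intervalIntegrable _ _)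
      ((cont_ball k3 R).intervalIntegrable _ _) fun τ hτ => ?_
    have i0 := int_ball k0 R τ
    have i1 := int_ball k1 R τ
    have i2 := int_ball k2 R τ
    have i3 := int_ball k3 R τ
    have z1 := (div_int g1 hB (τ := τ) fun x hx => by
      simp [wt_zero hR (k := 4) (by norm_num) hτ.1 hx]).1
    have z2 := (div_int g2 hB (τ := τ) fun x hx => by
      simp [wt_zero hR (k := 4) (by norm_num) hτ.1 hx]).2
    have := integral_mono i0 ((i1.add i2).add i3) fun x => hpt (τ, x)
    refine this.trans (le_of_eq ?_)
    have e3 := integral_add (i1.add i2) i3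
    have e4 := integral_add i1 i2
    simp only [Pi.add_apply] at e3 e4 ⊢
    rw [e3, e4, z1, z2]; simp
  rw [← hftc] at hint
  have ia := int_ball ((cw.continuous).fun_mul cQ.continuous) R
  have ib := int_ball ((cw.continuous.fun_mul cF.continuous).fun_mul hU.continuous) R
  rw [integral_sub ((ia s).const_mul _) (ib s), integral_sub ((ia 0).const_mul _) (ib 0),
    integral_const_mul, integral_const_mul] at hint
  simp only [hU0, mul_zero, integral_zero, sub_zero] at hint
  change (1 / 2 * Qen U R s - _) - 1 / 2 * Qen U R 0 ≤ _ at hint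
  linarith


lemma vR_facts {U : Pt → ℝ} (hU : ContDiff ℝ (⊤ : ℕ∞) U) {R s : ℝ} (hR : 0 < R) (hs : 0 ≤ s) :
    ContDiff ℝ 1 (fun x : ℝ × ℝ => wt R 3 (s, x) * U (s, x)) ∧
      HasCompactSupport (fun x : ℝ × ℝ => wt R 3 (s, x) * U (s, x)) := by
  constructor
  · have h1 : ContDiff ℝ 1 (fun p => wt R 3 p * U p) :=
      (wt_contDiff R 1).mul (hU.of_le (by norm_cast))
    exact h1.comp (by fun_prop : ContDiff ℝ 1 fun x : ℝ × ℝ => (s, x))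
  · refine HasCompactSupport.intro (isCompact_closedBall (0 : ℝ × ℝ) R) fun x hx => ?_
    rw [wt_zero hR (by norm_num) hs hx, zero_mul]

lemma vR_bound {C : ℝ} (hC : 0 < C) (hlady : ∀ v : ℝ × ℝ → ℝ, ContDiff ℝ 1 v → HasCompactSupport v →
    ∫ x, v x ^ 4 ≤ C * (∫ x, v x ^ 2) *
      ∫ x, ((fderiv ℝ v x (1, 0)) ^ 2 + (fderiv ℝ v x (0, 1)) ^ 2))
    {U : Pt → ℝ} (hU : ContDiff ℝ (⊤ : ℕ∞) U) (hU0 : ∀ x, U (0, x) = 0)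
    {R T t M : ℝ} (hR : 0 < R) (hT : 0 < T) (ht : 0 ≤ t) (htT : t ≤ T) (hTR : T ≤ R) (hM : 0 ≤ M)
    (hQ : ∀ s ∈ Set.Icc 0 t, Qen U R s ≤ M ^ 2) (s : ℝ) (hs : s ∈ Set.Icc 0 t) :
    eLpNorm (fun x : ℝ × ℝ => wt R 3 (s, x) * U (s, x)) 4 volume ≤
      ENNReal.ofReal ((584 * C + 1) * √T * M) := by
  obtain ⟨hv, hvs⟩ := vR_facts hU hR hs.1
  refine eLp4 hv.continuous hvs (by positivity) ?_
  have hP := Pen_bound hU hU0 hR hT ht htT hQ s hs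
  have hl := hlady _ hv hvs
  set v : ℝ × ℝ → ℝ := fun x => wt R 3 (s, x) * U (s, x) with hvdef
  set B := Metric.closedBall (0 : ℝ × ℝ) R with hB
  have cU := hU.continuous
  have cw4 := wt_cont R 4
  have cE := (edens_cd hU).continuous
  have hw : ∀ x : ℝ × ℝ, 0 ≤ wt R 4 (s, x) := fun x => wt_nonneg _ _ _
  have iP := int_ball (cw4.fun_mul (cU.fun_pow 2)) R s
  have iE := int_ball (cw4.fun_mul cE) R s
  have h2 : ∫ x, v x ^ 2 ≤ 4 * T ^ 2 * M ^ 2 := by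
    refine le_trans ?_ hP
    have e : ∫ x, v x ^ 2 = ∫ x in B, v x ^ 2 := by
      rw [setIntegral_eq_integral_of_forall_compl_eq_zero]
      intro x hx
      simp only [hvdef]
      rw [wt_zero hR (by norm_num) hs.1 hx]; simp
    rw [e]
    refine integral_mono (int_pow hv.continuous hvs 1).integrableOn iP fun x => ?_
    simp only [hvdef]
    rw [mul_pow, sq (wt R 3 _), wt_mul]
    exact mul_le_mul_of_nonneg_right (wt_anti hR (by norm_num) hs.1) (sq_nonneg _)
  have hfd : Continuous (fderiv ℝ v) := hv.continuous_fderiv (by norm_num)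
  have hfds : HasCompactSupport (fderiv ℝ v) := hvs.fderiv ℝ
  have h3 : ∫ x, ((fderiv ℝ v x (1, 0)) ^ 2 + (fderiv ℝ v x (0, 1)) ^ 2) ≤ 146 * M ^ 2 := by
    have e : ∫ x, ((fderiv ℝ v x (1, 0)) ^ 2 + (fderiv ℝ v x (0, 1)) ^ 2)
        = ∫ x in B, ((fderiv ℝ v x (1, 0)) ^ 2 + (fderiv ℝ v x (0, 1)) ^ 2) := by
      rw [setIntegral_eq_integral_of_forall_compl_eq_zero]
      intro x hx
      have : v =ᶠ[nhds x] fun _ => 0 := by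
        filter_upwards [(isCompact_closedBall (0 : ℝ × ℝ) R).isClosed.isOpen_compl.mem_nhds hx]
          with y hy
        simp only [hvdef]
        rw [wt_zero hR (by norm_num) hs.1 hy, zero_mul]
      rw [this.fderiv_eq]; simp
    rw [e]
    have hcI : Continuous fun x => (fderiv ℝ v x (1, 0)) ^ 2 + (fderiv ℝ v x (0, 1)) ^ 2 := by
      fun_prop
    have hpt : ∀ x, (fderiv ℝ v x (1, 0)) ^ 2 + (fderiv ℝ v x (0, 1)) ^ 2 ≤
        2 * (wt R 4 (s, x) * edens U (s, x)) + 18 / R ^ 2 * (wt R 4 (s, x) * U (s, x) ^ 2) := by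
      intro x
      have dw : DifferentiableAt ℝ (wt R 3) (s, x) :=
        (wt_contDiff R 1).differentiable (by norm_num) _
      have dU : DifferentiableAt ℝ U (s, x) := hU.differentiable (by simp) _
      have e := (slice_fderiv (dw.fun_mul dU)).fderiv
      have e1 : fderiv ℝ v x (1, 0) = wt R 3 (s, x) * vd1 U (s, x) + U (s, x) * vd1 (wt R 3) (s, x) := by
        simp only [hvdef]
        rw [e, fderiv_fun_mul dw dU]; simp [vd1]
      have e2 : fderiv ℝ v x (0, 1) = wt R 3 (s, x) * vd2 U (s, x) + U (s, x) * vd2 (wt R 3) (s, x) := by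
        simp only [hvdef]
        rw [e, fderiv_fun_mul dw dU]; simp [vd2]
      have w1' := wt_d1 R 1 (s, x)
      have w2' := wt_d2 R 1 (s, x)
      norm_num at w1' w2'
      rw [e1, e2, w1', w2']
      have hxi := jb_xi x
      set ξ := x.1 / jb x
      set η := x.2 / jb x
      have w32 : wt R 3 (s, x) ^ 2 ≤ wt R 4 (s, x) := by
        rw [sq, wt_mul]; exact wt_anti hR (by norm_num) hs.1
      have w22 : wt R 2 (s, x) ^ 2 = wt R 4 (s, x) := by rw [sq, wt_mul]
      set w3 := wt R 3 (s, x)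
      set w2 := wt R 2 (s, x)
      set w4 := wt R 4 (s, x)
      set a := vd1 U (s, x)
      set b := vd2 U (s, x)
      set y := U (s, x)
      have t1 : (w3 * a + y * (-(3 / R * w2 * ξ))) ^ 2 ≤ 2 * (w3 ^ 2 * a ^ 2) +
          18 / R ^ 2 * (w2 ^ 2 * y ^ 2) * ξ ^ 2 := by
        have : 0 ≤ (w3 * a - y * (-(3 / R * w2 * ξ))) ^ 2 := sq_nonneg _
        have e : (w3 * a + y * (-(3 / R * w2 * ξ))) ^ 2 = 2 * (w3 ^ 2 * a ^ 2) +
          18 / R ^ 2 * (w2 ^ 2 * y ^ 2) * ξ ^ 2 - (w3 * a - y * (-(3 / R * w2 * ξ))) ^ 2 := by ring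
        linarith
      have t2 : (w3 * b + y * (-(3 / R * w2 * η))) ^ 2 ≤ 2 * (w3 ^ 2 * b ^ 2) +
          18 / R ^ 2 * (w2 ^ 2 * y ^ 2) * η ^ 2 := by
        have : 0 ≤ (w3 * b - y * (-(3 / R * w2 * η))) ^ 2 := sq_nonneg _
        have e : (w3 * b + y * (-(3 / R * w2 * η))) ^ 2 = 2 * (w3 ^ 2 * b ^ 2) +
          18 / R ^ 2 * (w2 ^ 2 * y ^ 2) * η ^ 2 - (w3 * b - y * (-(3 / R * w2 * η))) ^ 2 := by ring
        linarith
      rw [w22] at t1 t2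
      have hw4 : 0 ≤ w4 := hw x
      have t3 : w3 ^ 2 * a ^ 2 + w3 ^ 2 * b ^ 2 ≤ w4 * edens U (s, x) := by
        have : a ^ 2 + b ^ 2 ≤ edens U (s, x) := by
          change a ^ 2 + b ^ 2 ≤ vdt U (s, x) ^ 2 + a ^ 2 + b ^ 2
          nlinarith [sq_nonneg (vdt U (s, x))]
        calc _ = w3 ^ 2 * (a ^ 2 + b ^ 2) := by ring
          _ ≤ _ := by gcongr
      have t4 : 18 / R ^ 2 * (w4 * y ^ 2) * (ξ ^ 2 + η ^ 2) ≤ 18 / R ^ 2 * (w4 * y ^ 2) :=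
        mul_le_of_le_one_right (by positivity) hxi
      linarith
    calc _ ≤ ∫ x in B, (2 * (wt R 4 (s, x) * edens U (s, x))
          + 18 / R ^ 2 * (wt R 4 (s, x) * U (s, x) ^ 2)) :=
          integral_mono (hcI.continuousOn.integrableOn_compact (isCompact_closedBall _ _))
            ((iE.const_mul _).add (iP.const_mul _)) hpt
      _ = 2 * Qen U R s + 18 / R ^ 2 * Pen U R s := by
          rw [integral_add (iE.const_mul _) (iP.const_mul _), integral_const_mul,
            integral_const_mul]; rfl
      _ ≤ 2 * M ^ 2 + 18 / R ^ 2 * (4 * T ^ 2 * M ^ 2) := by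
          have := hQ s hs
          gcongr
      _ = 2 * M ^ 2 + 72 * (T / R) ^ 2 * M ^ 2 := by field_simp; ring
      _ ≤ 2 * M ^ 2 + 72 * 1 ^ 2 * M ^ 2 := by
          have : T / R ≤ 1 := (div_le_one hR).2 hTR
          gcongr
      _ ≤ _ := by nlinarith [sq_nonneg M]
  have n1 : 0 ≤ ∫ x, v x ^ 2 := integral_nonneg fun x => sq_nonneg _
  calc _ ≤ _ := hl
    _ ≤ C * (4 * T ^ 2 * M ^ 2) * (146 * M ^ 2) := by
      gcongr
    _ = (584 * C) * (T ^ 2 * M ^ 4) := by ring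
    _ ≤ (584 * C + 1) ^ 4 * (T ^ 2 * M ^ 4) := by
      gcongr
      have h1 : 1 ≤ 584 * C + 1 := by linarith
      have := le_self_pow₀ h1 (n := 4) (by norm_num)
      linarith
    _ = ((584 * C + 1) * √T * M) ^ 4 := by
      have : √T ^ 4 = T ^ 2 := by
        rw [show 4 = 2 * 2 from rfl, pow_mul, Real.sq_sqrt hT.le]
      rw [mul_pow, mul_pow, this]; ring

lemma F_bound {F : Pt → ℝ} (hF : ContDiff ℝ (⊤ : ℕ∞) F) {v : ℝ × ℝ → ℝ} (hv : Continuous v)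
    {s t : ℝ} (hs : s ∈ Set.Icc 0 t) (hfin : eLpNorm v 4 volume ≠ ⊤) :
    ∫⁻ x, ‖F (s, x)‖ₑ * ‖v x‖ₑ ≤ (eLpNorm (fun x : ℝ × ℝ => F (0, x)) (4 / 3) volume +
      ∫⁻ τ in Set.Icc (0:ℝ) t, eLpNorm (fun x : ℝ × ℝ => vdt F (τ, x)) (4 / 3) volume)
        * eLpNorm v 4 volume := by
  have cF := hF.continuous
  have cf := (cd_vdt hF).continuous
  have hpt : ∀ x, ‖F (s, x)‖ₑ ≤ ‖F (0, x)‖ₑ + ∫⁻ τ in Set.Icc (0:ℝ) t, ‖vdt F (τ, x)‖ₑ := by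
    intro x
    have hc : Continuous fun τ : ℝ => vdt F (τ, x) := cf.comp (by fun_prop)
    have e := intervalIntegral.integral_eq_sub_of_hasDerivAt (a := 0) (b := s)
      (fun τ _ => slice_deriv (x := x) (hF.differentiable (by simp) (τ, x)))
      (hc.intervalIntegrable _ _)
    have e' : F (s, x) = F (0, x) + ∫ τ in (0:ℝ)..s, vdt F (τ, x) := by rw [e]; ring
    rw [e', intervalIntegral.integral_of_le hs.1]
    refine (enorm_add_le _ _).trans ?_
    gcongr
    refine (enorm_integral_le_lintegral_enorm _).trans ?_
    exact lintegral_mono_set fun τ hτ => ⟨hτ.1.le, hτ.2.trans hs.2⟩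
  have m0 : Measurable fun x : ℝ × ℝ => ‖F (0, x)‖ₑ * ‖v x‖ₑ := by
    have : Continuous fun x : ℝ × ℝ => F (0, x) := cF.comp (by fun_prop)
    exact this.enorm.measurable.mul hv.enorm.measurable
  have mj : Measurable (Function.uncurry fun (τ : ℝ) (x : ℝ × ℝ) => ‖vdt F (τ, x)‖ₑ * ‖v x‖ₑ) := by
    have h1 : Continuous fun q : ℝ × (ℝ × ℝ) => vdt F (q.1, q.2) := cf.comp (by fun_prop)
    have h2 : Continuous fun q : ℝ × (ℝ × ℝ) => v q.2 := hv.comp (by fun_prop)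
    exact h1.enorm.measurable.mul h2.enorm.measurable
  calc ∫⁻ x, ‖F (s, x)‖ₑ * ‖v x‖ₑ
      ≤ ∫⁻ x, (‖F (0, x)‖ₑ * ‖v x‖ₑ + ∫⁻ τ in Set.Icc (0:ℝ) t, ‖vdt F (τ, x)‖ₑ * ‖v x‖ₑ) := by
        refine lintegral_mono fun x => ?_
        rw [lintegral_mul_const' _ _ (by simp), ← add_mul]
        gcongr
        exact hpt x
    _ = (∫⁻ x, ‖F (0, x)‖ₑ * ‖v x‖ₑ)
          + ∫⁻ τ in Set.Icc (0:ℝ) t, ∫⁻ x, ‖vdt F (τ, x)‖ₑ * ‖v x‖ₑ := by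
        rw [lintegral_add_left m0, lintegral_lintegral_swap]
        exact (mj.comp measurable_swap).aemeasurable
    _ ≤ eLpNorm (fun x : ℝ × ℝ => F (0, x)) (4 / 3) volume * eLpNorm v 4 volume
          + ∫⁻ τ in Set.Icc (0:ℝ) t, eLpNorm (fun x : ℝ × ℝ => vdt F (τ, x)) (4 / 3) volume
            * eLpNorm v 4 volume := by
        gcongr
        · exact holder43 (cF.comp (by fun_prop)) hv
        · exact holder43 (cf.comp (by fun_prop)) hv
    _ = _ := by rw [lintegral_mul_const' _ _ hfin, add_mul]

lemma ball_int_le {g v : ℝ × ℝ → ℝ} {R : ℝ} {w : ℝ × ℝ → ℝ} (h : ∀ x, |w x| ≤ |g x * v x|) {X : ℝ}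
    (hX : 0 ≤ X) (hb : ∫⁻ x, ‖g x‖ₑ * ‖v x‖ₑ ≤ ENNReal.ofReal X) :
    ‖∫ x in Metric.closedBall (0 : ℝ × ℝ) R, w x‖ ≤ X := by
  rw [← ENNReal.ofReal_le_ofReal_iff hX, ofReal_norm]
  refine (enorm_integral_le_lintegral_enorm _).trans ?_
  refine (setLIntegral_le_lintegral _ _).trans ?_
  refine (lintegral_mono fun x => ?_).trans hb
  rw [← enorm_mul]
  rw [← ofReal_norm, ← ofReal_norm]
  exact ENNReal.ofReal_le_ofReal (h x)


lemma wt_abs_le {R : ℝ} (hR : 0 < R) {p : Pt} (hp : 0 ≤ p.1) (g y : ℝ) :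
    |wt R 4 p * g * y| ≤ |g * (wt R 3 p * y)| := by
  rw [abs_mul, abs_mul, abs_mul, abs_mul, abs_of_nonneg (wt_nonneg R 4 p),
    abs_of_nonneg (wt_nonneg R 3 p)]
  have : wt R 4 p ≤ wt R 3 p := wt_anti hR (by norm_num) hp
  calc _ = wt R 4 p * (|g| * |y|) := by ring
    _ ≤ wt R 3 p * (|g| * |y|) := by gcongr
    _ = _ := by ring

lemma lint_sq (g : ℝ × ℝ → ℝ) : ∫⁻ x, ‖g x‖ₑ ^ (2:ℝ) = eLpNorm g 2 volume ^ (2:ℝ) := by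
  rw [eLpNorm_eq_lintegral_rpow_enorm_toReal (by simp) (by simp), ← ENNReal.rpow_mul]
  simp

lemma Qen_main {C : ℝ} (hC : 0 < C) (hlady : ∀ v : ℝ × ℝ → ℝ, ContDiff ℝ 1 v → HasCompactSupport v →
    ∫ x, v x ^ 4 ≤ C * (∫ x, v x ^ 2) *
      ∫ x, ((fderiv ℝ v x (1, 0)) ^ 2 + (fderiv ℝ v x (0, 1)) ^ 2))
    {U : Pt → ℝ} (hU : ContDiff ℝ (⊤ : ℕ∞) U) (hU0 : ∀ x, U (0, x) = 0)
    {R T t A K : ℝ} (hR : 0 < R) (hT : 0 < T) (ht : 0 ≤ t) (htT : t ≤ T) (hTR : T ≤ R)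
    (hA : 0 ≤ A) (hK : 0 ≤ K)
    (hA' : eLpNorm (fun x : ℝ × ℝ => vdt U (0, x)) 2 volume ≤ ENNReal.ofReal A)
    (hK' : eLpNorm (fun x : ℝ × ℝ => box U (0, x)) (4 / 3) volume +
      ∫⁻ τ in Set.Icc (0:ℝ) t, eLpNorm (fun x : ℝ × ℝ => vdt (box U) (τ, x)) (4 / 3) volume
        ≤ ENNReal.ofReal K) :
    Qen U R t ≤ (A + 12 * (584 * C + 1) * √T * K) ^ 2 := by
  obtain ⟨s₀, hs₀, hmax⟩ := isCompact_Icc.exists_isMaxOn (Set.nonempty_Icc.2 ht)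
    (Qen_cont hU R).continuousOn
  have hQ0 : ∀ s, 0 ≤ Qen U R s := fun s =>
    integral_nonneg fun x => mul_nonneg (wt_nonneg _ _ _) (by unfold edens; positivity)
  set M := √(Qen U R s₀) with hMdef
  have hM : 0 ≤ M := Real.sqrt_nonneg _
  have hM2 : M ^ 2 = Qen U R s₀ := Real.sq_sqrt (hQ0 _)
  have hQ : ∀ s ∈ Set.Icc 0 t, Qen U R s ≤ M ^ 2 := fun s hs => by rw [hM2]; exact hmax hs
  have hV := vR_bound hC hlady hU hU0 hR hT ht htT hTR hM hQ
  set V := (584 * C + 1) * √T * M with hVdef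
  have hV0 : 0 ≤ V := by positivity
  have cF := cd_box hU
  have cfc := (cd_vdt cF).continuous
  have cFc := cF.continuous
  have cU := hU.continuous
  have cw4 := wt_cont R 4
  have cw3 := wt_cont R 3
  have hFV : ∀ s ∈ Set.Icc 0 t, ∫⁻ x, ‖box U (s, x)‖ₑ * ‖wt R 3 (s, x) * U (s, x)‖ₑ ≤
      ENNReal.ofReal (K * V) := by
    intro s hs
    have h := hV s hs
    refine (F_bound cF (vR_facts hU hR hs.1).1.continuous hs (ne_top_of_le_ne_top (by simp) h)).trans ?_
    rw [ENNReal.ofReal_mul hK]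
    gcongr
  have D1 : ∀ s ∈ Set.Icc 0 t,
      ‖∫ x in Metric.closedBall (0 : ℝ × ℝ) R, wt R 4 (s, x) * box U (s, x) * U (s, x)‖ ≤ K * V :=
    fun s hs => ball_int_le (fun x => wt_abs_le hR hs.1 _ _) (by positivity) (hFV s hs)
  have D2 : ∀ s ∈ Set.Icc 0 t,
      ‖∫ x in Metric.closedBall (0 : ℝ × ℝ) R, wt R 3 (s, x) * box U (s, x) * U (s, x)‖ ≤ K * V :=
    fun s hs => ball_int_le (fun x => le_of_eq (by congr 1; ring)) (by positivity) (hFV s hs)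
  have D3 : ‖∫ τ in (0:ℝ)..s₀, ∫ x in Metric.closedBall (0 : ℝ × ℝ) R,
      wt R 4 (τ, x) * vdt (box U) (τ, x) * U (τ, x)‖ ≤ K * V := by
    rw [← ENNReal.ofReal_le_ofReal_iff (by positivity), ofReal_norm,
      intervalIntegral.integral_of_le hs₀.1]
    refine (enorm_integral_le_lintegral_enorm _).trans ?_
    refine (lintegral_mono_set (t := Set.Icc 0 t)
      fun τ hτ => ⟨hτ.1.le, hτ.2.trans hs₀.2⟩).trans ?_
    calc _ ≤ ∫⁻ τ in Set.Icc (0:ℝ) t,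
          eLpNorm (fun x : ℝ × ℝ => vdt (box U) (τ, x)) (4 / 3) volume * ENNReal.ofReal V := by
          refine setLIntegral_mono' measurableSet_Icc fun τ hτ => ?_
          refine (enorm_integral_le_lintegral_enorm _).trans ?_
          refine (setLIntegral_le_lintegral _ _).trans ?_
          calc _ ≤ ∫⁻ x, ‖vdt (box U) (τ, x)‖ₑ * ‖wt R 3 (τ, x) * U (τ, x)‖ₑ := by
                refine lintegral_mono fun x => ?_
                rw [← enorm_mul, ← ofReal_norm, ← ofReal_norm]
                exact ENNReal.ofReal_le_ofReal (wt_abs_le hR hτ.1 _ _)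
            _ ≤ _ := holder43 (cfc.comp (by fun_prop)) (vR_facts hU hR hτ.1).1.continuous
            _ ≤ _ := by gcongr; exact hV τ hτ
      _ = (∫⁻ τ in Set.Icc (0:ℝ) t,
          eLpNorm (fun x : ℝ × ℝ => vdt (box U) (τ, x)) (4 / 3) volume) * ENNReal.ofReal V :=
          lintegral_mul_const' _ _ (by simp)
      _ ≤ ENNReal.ofReal K * ENNReal.ofReal V := by
          gcongr
          exact le_add_self.trans hK'
      _ = _ := (ENNReal.ofReal_mul hK).symm
  have hQA : Qen U R 0 ≤ A ^ 2 := by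
    rw [← ENNReal.ofReal_le_ofReal_iff (by positivity)]
    have i0 := int_ball (cw4.fun_mul (edens_cd hU).continuous) R 0
    unfold Qen
    rw [ofReal_integral_eq_lintegral_ofReal i0 (Filter.Eventually.of_forall fun x =>
      mul_nonneg (wt_nonneg _ _ _) (by unfold edens; positivity))]
    refine (setLIntegral_le_lintegral _ _).trans ?_
    calc _ ≤ ∫⁻ x : ℝ × ℝ, ‖vdt U (0, x)‖ₑ ^ (2:ℝ) := by
          refine lintegral_mono fun x => ?_
          obtain ⟨z1, z2⟩ := vd_zero (hU.differentiable (by simp)) hU0 x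
          rw [← ofReal_norm, ENNReal.ofReal_rpow_of_nonneg (norm_nonneg _) (by norm_num)]
          refine ENNReal.ofReal_le_ofReal ?_
          unfold edens
          rw [z1, z2, Real.rpow_two, Real.norm_eq_abs, sq_abs]
          have := wt_le_one hR 4 (p := (0, x)) le_rfl
          nlinarith [sq_nonneg (vdt U (0, x))]
      _ = eLpNorm (fun x : ℝ × ℝ => vdt U (0, x)) 2 volume ^ (2:ℝ) := lint_sq _
      _ ≤ ENNReal.ofReal A ^ (2:ℝ) := by gcongr
      _ = _ := by
          rw [ENNReal.ofReal_rpow_of_nonneg hA (by norm_num), Real.rpow_two]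
  have hE := energy_ineq hU hU0 hR hs₀.1
  have k3 : Continuous fun p => wt R 3 p * box U p * U p := by fun_prop
  have k4 : Continuous fun p => wt R 4 p * vdt (box U) p * U p := by fun_prop
  have hsplit : ∫ τ in (0:ℝ)..s₀, ∫ x in Metric.closedBall (0 : ℝ × ℝ) R,
        (4 / R * (wt R 3 (τ, x) * box U (τ, x) * U (τ, x)) -
          wt R 4 (τ, x) * vdt (box U) (τ, x) * U (τ, x)) =
      4 / R * (∫ τ in (0:ℝ)..s₀, ∫ x in Metric.closedBall (0 : ℝ × ℝ) R,
        wt R 3 (τ, x) * box U (τ, x) * U (τ, x)) -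
      ∫ τ in (0:ℝ)..s₀, ∫ x in Metric.closedBall (0 : ℝ × ℝ) R,
        wt R 4 (τ, x) * vdt (box U) (τ, x) * U (τ, x) := by
    rw [← intervalIntegral.integral_const_mul, ← intervalIntegral.integral_sub
      (((cont_ball k3 R).intervalIntegrable _ _).const_mul _) ((cont_ball k4 R).intervalIntegrable _ _)]
    refine intervalIntegral.integral_congr fun τ _ => ?_
    rw [integral_sub ((int_ball k3 R τ).const_mul _) (int_ball k4 R τ), integral_const_mul]
  have D2' : ‖∫ τ in (0:ℝ)..s₀, ∫ x in Metric.closedBall (0 : ℝ × ℝ) R,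
        wt R 3 (τ, x) * box U (τ, x) * U (τ, x)‖ ≤ K * V * |s₀ - 0| := by
    refine intervalIntegral.norm_integral_le_of_norm_le_const fun τ hτ => D2 τ ?_
    rw [Set.uIoc_of_le hs₀.1] at hτ
    exact ⟨hτ.1.le, hτ.2.trans hs₀.2⟩
  rw [hsplit, ← hM2] at hE
  have d1 := (le_abs_self _).trans (D1 s₀ hs₀)
  have d2 := (le_abs_self _).trans D2'
  have d3 := (neg_le_abs _).trans D3
  rw [sub_zero, abs_of_nonneg hs₀.1] at d2
  have d2' : 4 / R * (∫ τ in (0:ℝ)..s₀, ∫ x in Metric.closedBall (0 : ℝ × ℝ) R,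
        wt R 3 (τ, x) * box U (τ, x) * U (τ, x)) ≤ 4 * (K * V) := by
    calc _ ≤ 4 / R * (K * V * s₀) := by gcongr
      _ = 4 * (K * V) * (s₀ / R) := by ring
      _ ≤ 4 * (K * V) * 1 := by
        have : s₀ / R ≤ 1 := (div_le_one hR).2 (hs₀.2.trans (htT.trans hTR))
        gcongr
      _ = _ := by ring
  have hfin : M ^ 2 ≤ A ^ 2 + 12 * (584 * C + 1) * √T * K * M := by
    have e : 12 * (584 * C + 1) * √T * K * M = 12 * (K * V) := by rw [hVdef]; ring
    rw [e]
    linarith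
  have hb : 0 ≤ 12 * (584 * C + 1) * √T * K := by positivity
  set b := 12 * (584 * C + 1) * √T * K
  have hMle : M ≤ A + b := by
    by_contra! hlt
    nlinarith
  calc _ ≤ M ^ 2 := hQ t ⟨ht, le_rfl⟩
    _ ≤ _ := by gcongr

lemma wt_tendsto (k : ℕ) (p : Pt) :
    Filter.Tendsto (fun n : ℕ => wt (n:ℝ) k p) Filter.atTop (nhds 1) := by
  have h1 : Filter.Tendsto (fun n : ℕ => arg (n:ℝ) p) Filter.atTop (nhds 1) := by
    have := (tendsto_const_div_atTop_nhds_zero_nat (p.1 + jb p.2)).const_sub 1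
    simpa [arg] using this
  have h2 := (h1.max (tendsto_const_nhds (x := (0:ℝ)))).pow k
  simpa [wt] using h2

lemma main_U {C : ℝ} (hC : 0 < C) (hlady : ∀ v : ℝ × ℝ → ℝ, ContDiff ℝ 1 v → HasCompactSupport v →
    ∫ x, v x ^ 4 ≤ C * (∫ x, v x ^ 2) *
      ∫ x, ((fderiv ℝ v x (1, 0)) ^ 2 + (fderiv ℝ v x (0, 1)) ^ 2))
    {U : Pt → ℝ} (hU : ContDiff ℝ (⊤ : ℕ∞) U) (hU0 : ∀ x, U (0, x) = 0) {t : ℝ} (ht : 0 ≤ t) :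
    eLpNorm (fun x : ℝ × ℝ => vdt U (t, x)) 2 volume ≤
      eLpNorm (fun x : ℝ × ℝ => vdt U (0, x)) 2 volume +
      ENNReal.ofReal (12 * (584 * C + 1) * (1 + t) ^ ((1:ℝ) / 2)) *
       (eLpNorm (fun x : ℝ × ℝ => box U (0, x)) (4 / 3) volume +
      ∫⁻ τ in Set.Icc (0:ℝ) t, eLpNorm (fun x : ℝ × ℝ => vdt (box U) (τ, x)) (4 / 3) volume) := by
  set Ae := eLpNorm (fun x : ℝ × ℝ => vdt U (0, x)) 2 volume
  set Ke := eLpNorm (fun x : ℝ × ℝ => box U (0, x)) (4 / 3) volume +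
      ∫⁻ τ in Set.Icc (0:ℝ) t, eLpNorm (fun x : ℝ × ℝ => vdt (box U) (τ, x)) (4 / 3) volume
  rw [← Real.sqrt_eq_rpow]
  have hT : 0 < 1 + t := by linarith
  have hc : 0 < 12 * (584 * C + 1) * √(1 + t) := by
    have := Real.sqrt_pos.2 hT
    positivity
  by_cases hAt : Ae = ⊤
  · simp [hAt]
  by_cases hKt : Ke = ⊤
  · rw [hKt, ENNReal.mul_top (by simpa using hc)]; simp
  set A := Ae.toReal
  set K := Ke.toReal
  have hA : 0 ≤ A := ENNReal.toReal_nonneg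
  have hK : 0 ≤ K := ENNReal.toReal_nonneg
  have eA : ENNReal.ofReal A = Ae := ENNReal.ofReal_toReal hAt
  have eK : ENNReal.ofReal K = Ke := ENNReal.ofReal_toReal hKt
  have hu := (cd_vdt hU).continuous
  have hR : ∀ R : ℝ, 1 + t ≤ R → ∫⁻ x : ℝ × ℝ, ENNReal.ofReal (wt R 4 (t, x) * vdt U (t, x) ^ 2) ≤
      ENNReal.ofReal ((A + 12 * (584 * C + 1) * √(1 + t) * K) ^ 2) := by
    intro R hTR
    have hR0 : 0 < R := by linarith
    have h := Qen_main hC hlady hU hU0 hR0 hT ht (by linarith) hTR hA hK eA.ge eK.ge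
    refine le_trans ?_ (ENNReal.ofReal_le_ofReal h)
    have i0 := int_ball ((wt_cont R 4).fun_mul (edens_cd hU).continuous) R t
    unfold Qen
    rw [ofReal_integral_eq_lintegral_ofReal i0 (Filter.Eventually.of_forall fun x =>
      mul_nonneg (wt_nonneg _ _ _) (by unfold edens; positivity))]
    rw [← lintegral_indicator (Metric.isClosed_closedBall.measurableSet)]
    refine lintegral_mono fun x => ?_
    by_cases hx : x ∈ Metric.closedBall (0 : ℝ × ℝ) R
    · rw [Set.indicator_of_mem hx]
      refine ENNReal.ofReal_le_ofReal ?_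
      refine mul_le_mul_of_nonneg_left ?_ (wt_nonneg _ _ _)
      unfold edens
      nlinarith [sq_nonneg (vd1 U (t, x)), sq_nonneg (vd2 U (t, x))]
    · rw [wt_zero hR0 (by norm_num) ht hx]; simp
  have hlim : ∫⁻ x : ℝ × ℝ, ‖vdt U (t, x)‖ₑ ^ (2:ℝ) ≤
      ENNReal.ofReal ((A + 12 * (584 * C + 1) * √(1 + t) * K) ^ 2) := by
    have hF : ∀ x : ℝ × ℝ, ‖vdt U (t, x)‖ₑ ^ (2:ℝ) =
        Filter.liminf (fun n : ℕ => ENNReal.ofReal (wt (n:ℝ) 4 (t, x) * vdt U (t, x) ^ 2))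
          Filter.atTop := by
      intro x
      refine (Filter.Tendsto.liminf_eq ?_).symm
      have h1 := ENNReal.tendsto_ofReal ((wt_tendsto 4 (t, x)).mul_const (vdt U (t, x) ^ 2))
      rw [← ofReal_norm, ENNReal.ofReal_rpow_of_nonneg (norm_nonneg _) (by norm_num),
        Real.rpow_two, Real.norm_eq_abs, sq_abs]
      simpa using h1
    simp only [hF]
    refine (lintegral_liminf_le fun n => ?_).trans ?_
    · have z : Continuous fun x : ℝ × ℝ => wt (n:ℝ) 4 (t, x) * vdt U (t, x) ^ 2 :=
        ((wt_cont n 4).fun_mul (hu.fun_pow 2)).comp (by fun_prop)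
      exact z.measurable.ennreal_ofReal
    · refine Filter.liminf_le_of_frequently_le' (Filter.Eventually.frequently ?_)
      obtain ⟨N, hN⟩ := exists_nat_ge (1 + t)
      filter_upwards [Filter.eventually_ge_atTop N] with n hn
      exact hR n (hN.trans (by exact_mod_cast hn))
  rw [lint_sq, ← Real.rpow_two, ← ENNReal.ofReal_rpow_of_nonneg (by positivity) (by norm_num),
    ENNReal.rpow_le_rpow_iff (by norm_num)] at hlim
  refine hlim.trans (le_of_eq ?_)
  rw [ENNReal.ofReal_add hA (by positivity), ENNReal.ofReal_mul hc.le, eA, eK]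

/-- The `L²` estimate for the inhomogeneous wave equation on `ℝ^{1+2}`:
`‖u(t,·)‖_{L²} ≤ ‖u₀‖_{L²} + C(1+t)^{1/2}(‖u₁‖_{L^{4/3}} + ∫₀ᵗ ‖f(τ,·)‖_{L^{4/3}} dτ)`. -/
theorem stmt_9 :
    ∃ C > (0:ℝ), ∀ u₀ u₁ : ℝ × ℝ → ℝ, ∀ f u : Pt → ℝ,
      ContDiff ℝ (⊤ : ℕ∞) u₀ → HasCompactSupport u₀ →
      ContDiff ℝ (⊤ : ℕ∞) u₁ → HasCompactSupport u₁ →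
      ContDiff ℝ (⊤ : ℕ∞) f →
      (∀ τ : ℝ, HasCompactSupport (fun x : ℝ × ℝ => f (τ, x))) →
      ContDiff ℝ (⊤ : ℕ∞) u →
      (∀ p : Pt, 0 ≤ p.1 → box u p = f p) →
      (∀ x : ℝ × ℝ, u (0, x) = u₀ x) → (∀ x : ℝ × ℝ, vdt u (0, x) = u₁ x) →
      ∀ t : ℝ, 0 ≤ t →
        eLpNorm (fun x : ℝ × ℝ => u (t, x)) 2 volume ≤
          eLpNorm u₀ 2 volume +
            ENNReal.ofReal (C * (1 + t) ^ ((1:ℝ) / 2)) *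
              (eLpNorm u₁ (4 / 3) volume +
                ∫⁻ τ in Set.Icc (0:ℝ) t, eLpNorm (fun x : ℝ × ℝ => f (τ, x)) (4 / 3) volume) := by
  obtain ⟨C, hC, hlady⟩ := lady
  refine ⟨12 * (584 * C + 1), by positivity, ?_⟩
  intro u₀ u₁ f u _ _ _ _ _ _ hu hbox h0 h1 t ht
  obtain ⟨U, hU, hU0, hUu⟩ := exists_antideriv u hu
  have hm := main_U hC hlady hU hU0 ht
  have hb1 : ∀ x, box U (0, x) = u₁ x := by
    intro x
    have hd := fun x => vd_zero (hU.differentiable (by simp)) hU0 x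
    have e1 := (vd_zero ((cd_vd1 hU).differentiable (by simp)) (fun x => (hd x).1) x).1
    have e2 := (vd_zero ((cd_vd2 hU).differentiable (by simp)) (fun x => (hd x).2) x).2
    unfold box
    rw [e1, e2, hUu, h1]
    ring
  have hF : ∫⁻ τ in Set.Icc (0:ℝ) t, eLpNorm (fun x => vdt (box U) (τ, x)) (4 / 3) volume =
      ∫⁻ τ in Set.Icc (0:ℝ) t, eLpNorm (fun x : ℝ × ℝ => f (τ, x)) (4 / 3) volume := by
    refine setLIntegral_congr_fun measurableSet_Icc fun τ hτ => ?_
    have : (fun x : ℝ × ℝ => vdt (box U) (τ, x)) = fun x => f (τ, x) := by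
      funext x
      rw [vdt_box hU, hUu]
      exact hbox _ hτ.1
    simp only [this]
  rw [hF, hUu, funext hb1, funext h0] at hm
  exact hm
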